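/- arXiv:1104.2365 — 5 statements merged into one kernel-verified Lean document; each statement's English description precedes it below -/
import Mathlib

section
/- Let ε > 0, let ψ : ℝ → ℂ be a Schwartz function, let (c_n)_{n≥1} ⊂ ℂ satisfy Σ_{n=1}^∞ n |c_n| < ∞, set s(x) = Σ_{n=1}^∞ c_n e^{i n x}, and let φ : ℝ → ℝ be C² with φ'(t) > 0 and |φ''(t)| ≤ ε φ'(t) for all t and M'' := sup |φ''| < ∞. Then for every A₀ ≥ 0, a > 0 and b ∈ ℝ: | ∫_ℝ A₀ [ s(2π φ(t)) − s(2π (φ(b) + φ'(b)(t−b))) ] a^{−1/2} conj(ψ((t−b)/a)) dt | ≤ 2π ε A₀ (Σ_{n=1}^∞ n |c_n|) ( (1/2) a^{5/2} I₂ φ'(b) + (1/6) M'' a^{7/2} I₃ ). -/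
open Real MeasureTheory

/-- A function vanishing at `0` whose derivative is dominated on `[0, ∞)` by that of `g`
is dominated by `g` there. -/
lemma abs_le_of_abs_hasDerivAt_le {f f' g g' : ℝ → ℝ} (hf : ∀ t, HasDerivAt f (f' t) t)
    (hg : ∀ t, HasDerivAt g (g' t) t) (hf0 : f 0 = 0) (hg0 : g 0 = 0)
    (h : ∀ t, 0 ≤ t → |f' t| ≤ g' t) {t : ℝ} (ht : 0 ≤ t) : |f t| ≤ g t := by
  refine image_norm_le_of_norm_deriv_right_le_deriv_boundary (a := 0) (b := t)
    (fun x _ => (hf x).continuousAt.continuousWithinAt) (fun x _ => (hf x).hasDerivWithinAt)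
    (by simp [hf0, hg0]) hg (fun x hx => h x hx.1) ⟨ht, le_rfl⟩

/-- First-order Taylor estimate to the right of `b`, under `|f''| ≤ ε f'` and `|f''| ≤ M`. -/
lemma abs_taylor_remainder_le_of_le {ε M b : ℝ} (hε : 0 ≤ ε) {f f' f'' : ℝ → ℝ}
    (hf : ∀ t, HasDerivAt f (f' t) t) (hf' : ∀ t, HasDerivAt f' (f'' t) t)
    (h : ∀ t, |f'' t| ≤ ε * f' t) (hM : ∀ t, |f'' t| ≤ M) {t : ℝ} (ht : b ≤ t) :
    |f t - (f b + f' b * (t - b))| ≤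
      ε * (1 / 2 * f' b * |t - b| ^ 2 + 1 / 6 * M * |t - b| ^ 3) := by
  have hf_add (x : ℝ) : HasDerivAt (fun x => f (b + x)) (f' (b + x)) x := by
    simpa using (hf (b + x)).comp_const_add b x
  have hf'_add (x : ℝ) : HasDerivAt (fun x => f' (b + x) - f' b) (f'' (b + x)) x := by
    simpa using ((hf' (b + x)).comp_const_add b x).sub_const (f' b)
  have deriv_le (x : ℝ) (hx : 0 ≤ x) : |f' (b + x) - f' b| ≤ M * x :=
    abs_le_of_abs_hasDerivAt_le (g' := fun _ => M) hf'_add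
      (fun y => by simpa using (hasDerivAt_id y).const_mul M) (by simp) (by simp)
      (fun y _ => hM _) hx
  have deriv_le_eps (x : ℝ) (hx : 0 ≤ x) :
      |f' (b + x) - f' b| ≤ ε * (f' b * x + 1 / 2 * M * x ^ 2) := by
    refine abs_le_of_abs_hasDerivAt_le (g := fun x => ε * (f' b * x + 1 / 2 * M * x ^ 2))
      (g' := fun y => ε * (f' b + M * y)) hf'_add (fun y => ?_) (by simp) (by simp)
      (fun y hy => ?_) hx
    · refine HasDerivAt.congr_deriv ((((hasDerivAt_id y).const_mul (f' b)).add
        ((hasDerivAt_pow 2 y).const_mul (1 / 2 * M))).const_mul ε) ?_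
      push_cast
      ring
    · refine (h _).trans (mul_le_mul_of_nonneg_left ?_ hε)
      linarith [(abs_le.1 (deriv_le y hy)).2]
  have hx : 0 ≤ t - b := sub_nonneg.2 ht
  have key : |f (b + (t - b)) - (f b + f' b * (t - b))| ≤
      ε * (1 / 2 * f' b * (t - b) ^ 2 + 1 / 6 * M * (t - b) ^ 3) := by
    refine abs_le_of_abs_hasDerivAt_le (f := fun x => f (b + x) - (f b + f' b * x))
      (g := fun x => ε * (1 / 2 * f' b * x ^ 2 + 1 / 6 * M * x ^ 3))
      (fun y => (hf_add y).sub ?_) (fun y => ?_) (by simp) (by simp) deriv_le_eps hx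
    · simpa using ((hasDerivAt_id y).const_mul (f' b)).const_add (f b)
    · refine HasDerivAt.congr_deriv ((((hasDerivAt_pow 2 y).const_mul (1 / 2 * f' b)).add
        ((hasDerivAt_pow 3 y).const_mul (1 / 6 * M))).const_mul ε) ?_
      push_cast
      ring
  rw [abs_of_nonneg hx]
  simpa using key

/-- First-order Taylor estimate around `b`, under `|f''| ≤ ε f'` and `|f''| ≤ M`. -/
lemma abs_taylor_remainder_le {ε M : ℝ} (hε : 0 ≤ ε) {f f' f'' : ℝ → ℝ}
    (hf : ∀ t, HasDerivAt f (f' t) t) (hf' : ∀ t, HasDerivAt f' (f'' t) t)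
    (h : ∀ t, |f'' t| ≤ ε * f' t) (hM : ∀ t, |f'' t| ≤ M) (b t : ℝ) :
    |f t - (f b + f' b * (t - b))| ≤
      ε * (1 / 2 * f' b * |t - b| ^ 2 + 1 / 6 * M * |t - b| ^ 3) := by
  rcases le_total b t with hbt | htb
  · exact abs_taylor_remainder_le_of_le hε hf hf' h hM hbt
  · have key := abs_taylor_remainder_le_of_le hε (f := fun x => -f (-x)) (f' := fun x => f' (-x))
      (f'' := fun x => -f'' (-x)) (M := M)
      (fun x => ((hf (-x)).comp x (hasDerivAt_neg x)).neg.congr_deriv (by ring))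
      (fun x => ((hf' (-x)).comp x (hasDerivAt_neg x)).congr_deriv (by ring))
      (fun x => by simpa using h (-x)) (fun x => by simpa using hM (-x)) (neg_le_neg htb)
    have habs : |-t - -b| = |t - b| := by rw [← abs_neg]; congr 1; ring
    rw [habs] at key
    simp only [neg_neg] at key
    rw [← abs_neg]
    convert key using 2
    ring

/-- A one-sided Fourier series with `∑ n ‖c n‖ < ∞` is Lipschitz. -/
lemma norm_tsum_mul_exp_sub_le {c : ℕ → ℂ}
    (hc : Summable fun n : ℕ => ((n : ℝ) + 1) * ‖c (n + 1)‖) (x y : ℝ) :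
    ‖(∑' n : ℕ, c (n + 1) * Complex.exp (Complex.I * ((n : ℂ) + 1) * (x : ℂ))) -
        ∑' n : ℕ, c (n + 1) * Complex.exp (Complex.I * ((n : ℂ) + 1) * (y : ℂ))‖ ≤
      (∑' n : ℕ, ((n : ℝ) + 1) * ‖c (n + 1)‖) * |x - y| := by
  have exp_eq (n : ℕ) (x : ℝ) : Complex.exp (Complex.I * ((n : ℂ) + 1) * (x : ℂ)) =
      Complex.exp (Complex.I * (((n + 1) * x : ℝ) : ℂ)) := by
    push_cast
    ring_nf
  have norm_exp (n : ℕ) (x : ℝ) :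
      ‖Complex.exp (Complex.I * ((n : ℂ) + 1) * (x : ℂ))‖ = 1 := by
    rw [exp_eq, Complex.norm_exp_I_mul_ofReal]
  have summable_term (x : ℝ) : Summable fun n : ℕ =>
      c (n + 1) * Complex.exp (Complex.I * ((n : ℂ) + 1) * (x : ℂ)) := by
    refine Summable.of_norm_bounded hc fun n => ?_
    rw [norm_mul, norm_exp, mul_one]
    exact le_mul_of_one_le_left (norm_nonneg _) (by linarith [n.cast_nonneg (α := ℝ)])
  rw [← (summable_term x).tsum_sub (summable_term y), ← tsum_mul_right]
  refine tsum_of_norm_bounded (hc.mul_right _).hasSum fun n => ?_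
  have exp_sub_le : ‖Complex.exp (Complex.I * ((n : ℂ) + 1) * (x : ℂ)) -
      Complex.exp (Complex.I * ((n : ℂ) + 1) * (y : ℂ))‖ ≤ (n + 1) * |x - y| := by
    have hfactor : Complex.exp (Complex.I * ((n : ℂ) + 1) * (x : ℂ)) -
        Complex.exp (Complex.I * ((n : ℂ) + 1) * (y : ℂ)) =
        Complex.exp (Complex.I * ((n : ℂ) + 1) * (y : ℂ)) *
          (Complex.exp (Complex.I * (((n + 1) * (x - y) : ℝ) : ℂ)) - 1) := by
      rw [mul_sub, ← Complex.exp_add, mul_one]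
      push_cast
      ring_nf
    rw [hfactor, norm_mul, norm_exp, one_mul]
    refine Real.norm_exp_I_mul_ofReal_sub_one_le.trans_eq ?_
    rw [Real.norm_eq_abs, abs_mul, abs_of_nonneg (by positivity)]
  rw [← mul_sub, norm_mul]
  calc ‖c (n + 1)‖ * _ ≤ ‖c (n + 1)‖ * ((n + 1) * |x - y|) := by gcongr
    _ = _ := by ring

/-- With `s(x) = Σ_{n≥1} c_n e^{inx}`, `Σ n |c_n| < ∞`, `ψ` Schwartz,
`φ` C² with `φ' > 0`, `|φ''| ≤ ε φ'`, `M'' := sup|φ''| < ∞`, for every `A₀ ≥ 0`, `a > 0`, `b`: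
`|∫ A₀ [s(2πφ(t)) − s(2π(φ(b) + φ'(b)(t−b)))] a^{−1/2} conj(ψ((t−b)/a)) dt|
  ≤ 2πεA₀ (Σ n|c_n|) ((1/2) a^{5/2} I₂ φ'(b) + (1/6) M'' a^{7/2} I₃)`. -/
theorem statement5 (ε : ℝ) (hε : 0 < ε) (ψ : SchwartzMap ℝ ℂ) (c : ℕ → ℂ)
    (hc : Summable fun n : ℕ => ((n : ℝ) + 1) * ‖c (n + 1)‖)
    (s : ℝ → ℂ)
    (hs : ∀ x : ℝ, s x = ∑' n : ℕ, c (n + 1) * Complex.exp (Complex.I * ((n : ℂ) + 1) * (x : ℂ)))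
    (φ : ℝ → ℝ) (hφ : ContDiff ℝ 2 φ) (hφ' : ∀ t, 0 < deriv φ t)
    (hφ'' : ∀ t, |deriv (deriv φ) t| ≤ ε * deriv φ t)
    (hM : BddAbove (Set.range fun t => |deriv (deriv φ) t|)) :
    ∀ A₀ : ℝ, 0 ≤ A₀ → ∀ a b : ℝ, 0 < a →
      ‖∫ t : ℝ, (A₀ : ℂ) * (s (2 * π * φ t) - s (2 * π * (φ b + deriv φ b * (t - b)))) *
          ((Real.sqrt a : ℂ))⁻¹ * starRingEnd ℂ (ψ ((t - b) / a))‖ ≤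
        2 * π * ε * A₀ * (∑' n : ℕ, ((n : ℝ) + 1) * ‖c (n + 1)‖) *
          ((1 / 2) * a ^ ((5 : ℝ) / 2) * (∫ x : ℝ, |x| ^ 2 * ‖ψ x‖) * deriv φ b +
            (1 / 6) * (⨆ t, |deriv (deriv φ) t|) * a ^ ((7 : ℝ) / 2) *
              (∫ x : ℝ, |x| ^ 3 * ‖ψ x‖)) := by
  intro A₀ hA a b ha
  set C := ∑' n : ℕ, ((n : ℝ) + 1) * ‖c (n + 1)‖
  set M := ⨆ t, |deriv (deriv φ) t|
  have hC : 0 ≤ C := tsum_nonneg fun n => by positivity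
  have hderiv (t : ℝ) : HasDerivAt φ (deriv φ t) t :=
    (hφ.differentiable (by norm_num) t).hasDerivAt
  have hderiv2 (t : ℝ) : HasDerivAt (deriv φ) (deriv (deriv φ) t) t :=
    (hφ.differentiable_deriv_two t).hasDerivAt
  have taylor := abs_taylor_remainder_le hε.le hderiv hderiv2 hφ'' (le_ciSup hM) b
  have lipschitz (x y : ℝ) : ‖s x - s y‖ ≤ C * |x - y| := by
    rw [hs, hs]
    exact norm_tsum_mul_exp_sub_le hc x y
  let F : ℝ → ℝ := fun x => 2 * π * ε * A₀ * C * (√a)⁻¹ *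
    (1 / 2 * deriv φ b * a ^ 2 * (|x| ^ 2 * ‖ψ x‖) + 1 / 6 * M * a ^ 3 * (|x| ^ 3 * ‖ψ x‖))
  have integrable_moment (k : ℕ) : Integrable fun x : ℝ => |x| ^ k * ‖ψ x‖ :=
    ψ.integrable_pow_mul volume k
  have hF : Integrable F :=
    (((integrable_moment 2).const_mul _).add ((integrable_moment 3).const_mul _)).const_mul _
  have norm_le (t : ℝ) : ‖(A₀ : ℂ) * (s (2 * π * φ t) -
      s (2 * π * (φ b + deriv φ b * (t - b)))) * ((Real.sqrt a : ℂ))⁻¹ *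
      starRingEnd ℂ (ψ ((t - b) / a))‖ ≤ F ((t - b) / a) := by
    have hs_le : ‖s (2 * π * φ t) - s (2 * π * (φ b + deriv φ b * (t - b)))‖ ≤
        C * (2 * π * (ε * (1 / 2 * deriv φ b * |t - b| ^ 2 + 1 / 6 * M * |t - b| ^ 3))) := by
      refine (lipschitz _ _).trans (mul_le_mul_of_nonneg_left ?_ hC)
      rw [← mul_sub, abs_mul, abs_of_pos two_pi_pos]
      exact mul_le_mul_of_nonneg_left (taylor t) two_pi_pos.le
    have habs : |t - b| = a * |(t - b) / a| := by
      rw [abs_div, abs_of_pos ha, mul_div_cancel₀ _ ha.ne']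
    rw [norm_mul, norm_mul, norm_mul, norm_inv, Complex.norm_of_nonneg hA,
      Complex.norm_of_nonneg (Real.sqrt_nonneg a), RCLike.norm_conj]
    calc A₀ * ‖s (2 * π * φ t) - s (2 * π * (φ b + deriv φ b * (t - b)))‖ * (√a)⁻¹ *
          ‖ψ ((t - b) / a)‖
        ≤ A₀ * (C * (2 * π * (ε * (1 / 2 * deriv φ b * |t - b| ^ 2 +
            1 / 6 * M * |t - b| ^ 3)))) * (√a)⁻¹ * ‖ψ ((t - b) / a)‖ := by gcongr
      _ = F ((t - b) / a) := by
        simp only [F, habs]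
        ring
  have hF_comp : Integrable fun t => F ((t - b) / a) :=
    (hF.comp_div ha.ne').comp_sub_right b
  have rpow_add_half (k : ℕ) (p : ℝ) (hp : p = k + 1 / 2) : a ^ p = a ^ k * √a := by
    rw [hp, Real.rpow_add ha, Real.rpow_natCast, Real.sqrt_eq_rpow]
  refine (norm_integral_le_of_norm_le hF_comp (.of_forall norm_le)).trans_eq ?_
  rw [integral_sub_right_eq_self (fun t => F (t / a)) b, Measure.integral_comp_div,
    abs_of_pos ha, smul_eq_mul, integral_const_mul,
    integral_add ((integrable_moment 2).const_mul _) ((integrable_moment 3).const_mul _),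
    integral_const_mul, integral_const_mul, rpow_add_half 2 _ (by norm_num),
    rpow_add_half 3 _ (by norm_num)]
  have ha_inv : a * (√a)⁻¹ = √a := by
    rw [← div_eq_mul_inv, Real.div_sqrt]
  linear_combination (2 * π * ε * A₀ * C *
    (1 / 2 * deriv φ b * a ^ 2 * (∫ x : ℝ, |x| ^ 2 * ‖ψ x‖) +
      1 / 6 * M * a ^ 3 * ∫ x : ℝ, |x| ^ 3 * ‖ψ x‖)) * ha_inv
end

section
/- Let ε > 0 and K ≥ 1 an integer. Let ψ : ℝ → ℂ be a Schwartz function. For k = 1,…,K let s_k : ℝ → ℂ be bounded measurable, A_k : ℝ → (0,∞) be C¹ and bounded, and φ_k : ℝ → ℝ be C² with φ'_k(t) > 0 for all t, M''_k := sup |φ''_k| < ∞, and |A'_k(t)| ≤ ε φ'_k(t) for all t. Set f(t) = Σ_{k=1}^K A_k(t) s_k(2π φ_k(t)) and W_f(a,b) = ∫_ℝ f(t) a^{−1/2} conj(ψ((t−b)/a)) dt. Then for all a > 0 and b ∈ ℝ: | W_f(a,b) − Σ_{k=1}^K ∫_ℝ A_k(b) s_k(2π φ_k(t)) a^{−1/2}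 conj(ψ((t−b)/a)) dt | ≤ ε Σ_{k=1}^K (sup|s_k|) ( φ'_k(b) a^{3/2} I₁ + (1/2) M''_k a^{5/2} I₂ ). -/
open Real MeasureTheory

/-- If `|A'| ≤ ε φ'` and `|φ''| ≤ M`, then `A` differs from `A b` by at most `ε` times the
second-order Taylor majorant of `φ` at `b`. -/
theorem abs_sub_le_of_abs_deriv_le_mul_deriv {ε M : ℝ} (hε : 0 ≤ ε) {A φ : ℝ → ℝ}
    (hA : Differentiable ℝ A) (hφ : Differentiable ℝ (deriv φ))
    (hM : ∀ t, |deriv (deriv φ) t| ≤ M)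
    (hA' : ∀ t, |deriv A t| ≤ ε * deriv φ t) (b t : ℝ) :
    |A t - A b| ≤ ε * (deriv φ b * |t - b| + 1 / 2 * M * |t - b| ^ 2) := by
  have hlip (y : ℝ) : |deriv φ y - deriv φ b| ≤ M * |y - b| :=
    convex_univ.norm_image_sub_le_of_norm_deriv_le (fun x _ => hφ x) (fun x _ => hM x)
      (Set.mem_univ b) (Set.mem_univ y)
  have hline (u : ℝ) : HasDerivAt (fun u : ℝ => b + u * (t - b)) (t - b) u := by
    simpa using ((hasDerivAt_id u).mul_const (t - b)).const_add b
  have hder (u : ℝ) : HasDerivAt (fun u : ℝ => A (b + u * (t - b)) - A b)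
      (deriv A (b + u * (t - b)) * (t - b)) u :=
    ((hA _).hasDerivAt.comp u (hline u)).sub_const _
  have hB (u : ℝ) : HasDerivAt
      (fun u : ℝ => ε * (deriv φ b * |t - b| * u + 1 / 2 * M * |t - b| ^ 2 * u ^ 2))
      (ε * (deriv φ b + M * (u * |t - b|)) * |t - b|) u := by
    have h := ((((hasDerivAt_id u).const_mul (deriv φ b * |t - b|)).add
      ((hasDerivAt_pow 2 u).const_mul (1 / 2 * M * |t - b| ^ 2))).const_mul ε)
    refine h.congr_deriv ?_
    push_cast
    ring
  have key := image_norm_le_of_norm_deriv_right_le_deriv_boundary (a := 0) (b := 1)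
    (fun u _ => (hder u).continuousAt.continuousWithinAt)
    (fun u _ => (hder u).hasDerivWithinAt) (by simp) hB (fun u hu => by
      rw [norm_mul, Real.norm_eq_abs, Real.norm_eq_abs]
      have h1 := hlip (b + u * (t - b))
      rw [add_sub_cancel_left, abs_mul, abs_of_nonneg hu.1] at h1
      have h2 := (abs_le.1 h1).2
      exact mul_le_mul_of_nonneg_right
        ((hA' _).trans (mul_le_mul_of_nonneg_left (by linarith) hε)) (abs_nonneg _))
    (Set.right_mem_Icc.2 zero_le_one)
  simpa using key

/-- The integral of a weight `p |t - b| + q |t - b|²` against the `L²`-normalised dilate of `|ψ|`,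
expressed through the first two absolute moments of `ψ`. -/
theorem integrable_and_integral_moments_dilate (ψ : SchwartzMap ℝ ℂ) (p q b : ℝ) {a : ℝ}
    (ha : 0 < a) :
    Integrable (fun t : ℝ =>
      (p * |t - b| + q * |t - b| ^ 2) * ((√a)⁻¹ * ‖ψ ((t - b) / a)‖)) ∧
    ∫ t : ℝ, (p * |t - b| + q * |t - b| ^ 2) * ((√a)⁻¹ * ‖ψ ((t - b) / a)‖) =
      p * a ^ ((3 : ℝ) / 2) * (∫ x : ℝ, |x| * ‖ψ x‖) +
        q * a ^ ((5 : ℝ) / 2) * (∫ x : ℝ, |x| ^ 2 * ‖ψ x‖) := by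
  have hi1 : Integrable (fun x : ℝ => |x| * ‖ψ x‖) := by
    simpa using ψ.integrable_pow_mul volume 1
  have hi2 : Integrable (fun x : ℝ => |x| ^ 2 * ‖ψ x‖) := by
    simpa only [Real.norm_eq_abs] using ψ.integrable_pow_mul volume 2
  set g : ℝ → ℝ := fun x =>
    p * a * (√a)⁻¹ * (|x| * ‖ψ x‖) + q * a ^ 2 * (√a)⁻¹ * (|x| ^ 2 * ‖ψ x‖) with hg
  have hgi : Integrable g := (hi1.const_mul _).add (hi2.const_mul _)
  have hfun : (fun t : ℝ =>
      (p * |t - b| + q * |t - b| ^ 2) * ((√a)⁻¹ * ‖ψ ((t - b) / a)‖)) =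
      fun t => g ((t - b) / a) := by
    ext t
    simp only [hg, abs_div, abs_of_pos ha]
    field_simp
  rw [hfun]
  refine ⟨(hgi.comp_div ha.ne').comp_sub_right b, ?_⟩
  rw [integral_sub_right_eq_self (fun t => g (t / a)) b, Measure.integral_comp_div,
    abs_of_pos ha, hg, integral_add (hi1.const_mul _) (hi2.const_mul _), integral_const_mul,
    integral_const_mul, smul_eq_mul]
  have hs : √a ≠ 0 := (Real.sqrt_pos.2 ha).ne'
  have hsq : √a * √a = a := Real.mul_self_sqrt ha.le
  have h3 : a ^ ((3 : ℝ) / 2) = a * √a := by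
    rw [show (3 : ℝ) / 2 = 1 + 1 / 2 by norm_num, Real.rpow_add ha, Real.rpow_one,
      ← Real.sqrt_eq_rpow]
  have h5 : a ^ ((5 : ℝ) / 2) = a ^ 2 * √a := by
    rw [show (5 : ℝ) / 2 = (2 : ℕ) + 1 / 2 by norm_num, Real.rpow_add ha, Real.rpow_natCast,
      ← Real.sqrt_eq_rpow]
  have hinv : a * (√a)⁻¹ = √a := by field_simp; linarith [hsq]
  rw [h3, h5]
  linear_combination (p * a * (∫ x : ℝ, |x| * ‖ψ x‖) +
    q * a ^ 2 * (∫ x : ℝ, |x| ^ 2 * ‖ψ x‖)) * hinv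

/-- A bounded measurable function times a conjugated dilate of a Schwartz function is integrable. -/
theorem integrable_bounded_mul_dilate (ψ : SchwartzMap ℝ ℂ) {h : ℝ → ℂ} (hm : Measurable h)
    {C : ℝ} (hC : ∀ t, ‖h t‖ ≤ C) (c : ℂ) {a : ℝ} (ha : a ≠ 0) (b : ℝ) :
    Integrable fun t : ℝ => h t * c * starRingEnd ℂ (ψ ((t - b) / a)) := by
  have hψ : Integrable fun t : ℝ => ψ ((t - b) / a) :=
    (ψ.integrable.comp_div ha).comp_sub_right b
  have hψ' : Integrable fun t : ℝ => starRingEnd ℂ (ψ ((t - b) / a)) :=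
    (Complex.conjLIE.toContinuousLinearEquiv.toContinuousLinearMap).integrable_comp hψ
  have h2 := (hψ'.const_mul c).bdd_mul hm.aestronglyMeasurable (Filter.Eventually.of_forall hC)
  simpa only [mul_assoc] using h2

/-- With `f(t) = Σ_{k=1}^K A_k(t) s_k(2π φ_k(t))` and
`W_f(a,b) = ∫ f(t) a^{−1/2} conj(ψ((t−b)/a)) dt`, for all `a > 0`, `b ∈ ℝ`:
`|W_f(a,b) − Σ_k ∫ A_k(b) s_k(2πφ_k(t)) a^{−1/2} conj(ψ((t−b)/a)) dt|
  ≤ ε Σ_k (sup|s_k|) (φ'_k(b) a^{3/2} I₁ + (1/2) M''_k a^{5/2} I₂)`. -/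
theorem statement6 (ε : ℝ) (hε : 0 < ε) (K : ℕ) (hK : 1 ≤ K)
    (ψ : SchwartzMap ℝ ℂ)
    (s : ℕ → ℝ → ℂ) (hs : ∀ k, Measurable (s k)) (hsb : ∀ k, ∃ C, ∀ x, ‖s k x‖ ≤ C)
    (A φ : ℕ → ℝ → ℝ)
    (hA : ∀ k, ContDiff ℝ 1 (A k)) (hApos : ∀ k t, 0 < A k t)
    (hAb : ∀ k, ∃ C, ∀ t, A k t ≤ C)
    (hφ : ∀ k, ContDiff ℝ 2 (φ k)) (hφ' : ∀ k t, 0 < deriv (φ k) t)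
    (hM : ∀ k, BddAbove (Set.range fun t => |deriv (deriv (φ k)) t|))
    (hA' : ∀ k, 1 ≤ k → k ≤ K → ∀ t, |deriv (A k) t| ≤ ε * deriv (φ k) t)
    (f : ℝ → ℂ)
    (hf : ∀ t, f t = ∑ k ∈ Finset.Icc 1 K, (A k t : ℂ) * s k (2 * π * φ k t))
    (W : ℝ → ℝ → ℂ)
    (hW : ∀ a b : ℝ, W a b =
      ∫ t : ℝ, f t * ((Real.sqrt a : ℂ))⁻¹ * starRingEnd ℂ (ψ ((t - b) / a))) :
    ∀ a b : ℝ, 0 < a →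
      ‖W a b - ∑ k ∈ Finset.Icc 1 K,
          ∫ t : ℝ, (A k b : ℂ) * s k (2 * π * φ k t) * ((Real.sqrt a : ℂ))⁻¹ *
            starRingEnd ℂ (ψ ((t - b) / a))‖ ≤
        ε * ∑ k ∈ Finset.Icc 1 K,
          (⨆ x, ‖s k x‖) *
            (deriv (φ k) b * a ^ ((3 : ℝ) / 2) * (∫ x : ℝ, |x| * ‖ψ x‖) +
              (1 / 2) * (⨆ t, |deriv (deriv (φ k)) t|) * a ^ ((5 : ℝ) / 2) *
                (∫ x : ℝ, |x| ^ 2 * ‖ψ x‖)) := by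
  intro a b ha
  have hm (k : ℕ) : Measurable fun t => s k (2 * π * φ k t) :=
    (hs k).comp ((hφ k).continuous.measurable.const_mul _)
  have hsup (k : ℕ) (x : ℝ) : ‖s k x‖ ≤ ⨆ x, ‖s k x‖ := by
    obtain ⟨C, hC⟩ := hsb k
    exact le_ciSup (f := fun x => ‖s k x‖) ⟨C, by rintro _ ⟨y, rfl⟩; exact hC y⟩ x
  have hint (k : ℕ) : Integrable fun t : ℝ => (A k t : ℂ) * s k (2 * π * φ k t) *
      ((√a : ℂ))⁻¹ * starRingEnd ℂ (ψ ((t - b) / a)) := by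
    obtain ⟨C, hC⟩ := hAb k
    refine integrable_bounded_mul_dilate ψ
      ((Complex.measurable_ofReal.comp (hA k).continuous.measurable).mul (hm k))
      (C := C * ⨆ x, ‖s k x‖) (fun t => ?_) _ ha.ne' b
    simp only [Pi.mul_apply, Function.comp_apply, norm_mul, Complex.norm_real, Real.norm_eq_abs,
      abs_of_pos (hApos k t)]
    exact mul_le_mul (hC t) (hsup k _) (norm_nonneg _) ((hApos k t).le.trans (hC t))
  have hint' (k : ℕ) : Integrable fun t : ℝ => (A k b : ℂ) * s k (2 * π * φ k t) *
      ((√a : ℂ))⁻¹ * starRingEnd ℂ (ψ ((t - b) / a)) := by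
    refine integrable_bounded_mul_dilate ψ ((hm k).const_mul _)
      (C := A k b * ⨆ x, ‖s k x‖) (fun t => ?_) _ ha.ne' b
    rw [norm_mul, Complex.norm_real, Real.norm_eq_abs, abs_of_pos (hApos k b)]
    exact mul_le_mul_of_nonneg_left (hsup k _) (hApos k b).le
  have hWsum : W a b = ∑ k ∈ Finset.Icc 1 K, ∫ t : ℝ, (A k t : ℂ) * s k (2 * π * φ k t) *
      ((√a : ℂ))⁻¹ * starRingEnd ℂ (ψ ((t - b) / a)) := by
    rw [hW, ← integral_finsetSum _ fun k _ => hint k]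
    simp only [hf, Finset.sum_mul]
  rw [hWsum, ← Finset.sum_sub_distrib, Finset.mul_sum]
  refine (norm_sum_le _ _).trans (Finset.sum_le_sum fun k hk => ?_)
  obtain ⟨hk1, hkK⟩ := Finset.mem_Icc.1 hk
  rw [← integral_sub (hint k) (hint' k)]
  obtain ⟨hgi, hgv⟩ := integrable_and_integral_moments_dilate ψ (deriv (φ k) b)
    (1 / 2 * ⨆ t, |deriv (deriv (φ k)) t|) b ha
  rw [← hgv, ← mul_assoc, ← integral_const_mul]
  refine norm_integral_le_of_norm_le (hgi.const_mul _) (Filter.Eventually.of_forall fun t => ?_)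
  have hAt := abs_sub_le_of_abs_deriv_le_mul_deriv hε.le ((hA k).differentiable one_ne_zero)
    ((contDiff_succ_iff_deriv.1 (hφ k)).2.2.differentiable one_ne_zero)
    (fun t => le_ciSup (hM k) t) (hA' k hk1 hkK) b t
  rw [← sub_mul, ← sub_mul, ← sub_mul, norm_mul, norm_mul, norm_mul, RCLike.norm_conj,
    ← Complex.ofReal_sub, Complex.norm_real, norm_inv, Complex.norm_real, Real.norm_eq_abs,
    Real.norm_of_nonneg (Real.sqrt_nonneg a)]
  have hψ0 : 0 ≤ (√a)⁻¹ * ‖ψ ((t - b) / a)‖ := by positivity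
  calc _ = |A k t - A k b| * ‖s k (2 * π * φ k t)‖ * ((√a)⁻¹ * ‖ψ ((t - b) / a)‖) := by ring
    _ ≤ _ := mul_le_mul_of_nonneg_right (mul_le_mul hAt (hsup k _) (norm_nonneg _)
        ((abs_nonneg _).trans hAt)) hψ0
    _ = _ := by ring
end

section
/- Let ε > 0, Δ ∈ (0,1), and integers K ≥ 1, D ≥ 1. Let ψ : ℝ → ℂ be a Schwartz function whose Fourier transform ψ̂(ξ) = ∫_ℝ ψ(t) e^{−2πi t ξ} dt is supported in [1−Δ, 1+Δ]. For k = 1,…,K let s_k(x) = Σ_{n=1}^∞ c_{k,n} e^{i n x} with Σ_{n=1}^∞ n |c_{k,n}| < ∞ and Σ_{n>D} n |c_{k,n}| ≤ ε; let A_k : ℝ → (0,∞) be C¹ and bounded; let φ_k : ℝ → ℝ be C² with φ'_k(t) > 0 for all t, M''_k := sup |φ''_k| < ∞, |A'_k(t)| ≤ ε φ'_k(t) and |φ''_k(t)| ≤ ε φ'_k(t) for all t. Set f(t) = Σ_{k=1}^K A_k(t) s_k(2π φ_k(t)) and W_f(a,b) = ∫_ℝ f(t) a^{−1/2} conj(ψ((t−b)/a))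 dt. If a > 0 and b ∈ ℝ are such that |a n φ'_k(b) − 1| ≥ Δ for every k ∈ {1,…,K} and n ∈ {1,…,D}, then |W_f(a,b)| ≤ ε a^{1/2} Σ_{k=1}^K [ (sup|s_k|) (φ'_k(b) a I₁ + (M''_k/2) a² I₂) + π A_k(b) (Σ_{j≥1} j |c_{k,j}|) (a² I₂ φ'_k(b) + (M''_k/3) a³ I₃) + I₀ A_k(b) ]. -/
open Real MeasureTheory

/-- A function vanishing at `0` whose derivative at `u` is bounded by `B' |u|` is itself bounded by
`B |u|`. -/
theorem abs_le_comp_abs_of_abs_deriv_le {g g' B B' : ℝ → ℝ} (hg : ∀ u, HasDerivAt g (g' u) u)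
    (hB : ∀ u, HasDerivAt B (B' u) u) (g0 : g 0 = 0) (B0 : B 0 = 0)
    (h : ∀ u, |g' u| ≤ B' |u|) (y : ℝ) : |g y| ≤ B |y| := by
  have key : ∀ (g g' : ℝ → ℝ), (∀ u, HasDerivAt g (g' u) u) → g 0 = 0 →
      (∀ u, |g' u| ≤ B' |u|) → ∀ y, 0 ≤ y → |g y| ≤ B y := by
    intro g g' hg g0 h y hy
    refine image_norm_le_of_norm_deriv_right_le_deriv_boundary (f := g) (f' := g') (a := 0) (b := y)
      (fun u _ => (hg u).continuousAt.continuousWithinAt) (fun u _ => (hg u).hasDerivWithinAt)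
      (by simp [g0, B0]) hB (fun u hu => ?_) ⟨hy, le_rfl⟩
    simpa [abs_of_nonneg hu.1] using h u
  rcases le_total 0 y with hy | hy
  · simpa [abs_of_nonneg hy] using key g g' hg g0 h y hy
  · have := key (fun u => g (-u)) (fun u => -g' (-u))
      (fun u => (HasDerivAt.scomp u (hg (-u)) (hasDerivAt_neg u)).congr_deriv (by simp)) (by simpa using g0)
      (fun u => by simpa using h (-u)) (-y) (by linarith)
    simpa [abs_of_nonpos hy] using this

/-- If `|A'| ≤ ε p` with `p` of slope at most `M`, then `A` varies slowly around `b`. -/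
theorem abs_sub_le_of_abs_deriv_le {ε M : ℝ} (hε : 0 ≤ ε) {A A' p p' : ℝ → ℝ}
    (hA : ∀ t, HasDerivAt A (A' t) t) (hp : ∀ t, HasDerivAt p (p' t) t)
    (hM : ∀ t, |p' t| ≤ M) (hAp : ∀ t, |A' t| ≤ ε * p t) (b y : ℝ) :
    |A (b + y) - A b| ≤ ε * (p b * |y| + M / 2 * |y| ^ 2) := by
  have h1 : ∀ u, |p (b + u) - p b| ≤ M * |u| := fun u =>
    abs_le_comp_abs_of_abs_deriv_le (g := fun u => p (b + u) - p b) (g' := fun u => p' (b + u))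
      (B := fun u => M * u) (B' := fun _ => M)
      (fun u => ((hp (b + u)).comp_const_add b u).sub_const _)
      (fun u => by simpa using (hasDerivAt_id u).const_mul M) (by simp) (by simp)
      (fun u => hM _) u
  refine abs_le_comp_abs_of_abs_deriv_le (g := fun u => A (b + u) - A b)
      (g' := fun u => A' (b + u))
      (B := fun u => ε * (p b * u + M / 2 * u ^ 2)) (B' := fun u => ε * (p b + M * u))
      (fun u => ((hA (b + u)).comp_const_add b u).sub_const _) (fun u => ?_) (by simp) (by simp)
      (fun u => ?_) y
  · refine ((((hasDerivAt_id' u).const_mul (p b)).add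
      ((hasDerivAt_pow 2 u).const_mul (M / 2))).const_mul ε).congr_deriv ?_
    norm_num
    left; ring
  · refine (hAp _).trans (mul_le_mul_of_nonneg_left ?_ hε)
    linarith [(abs_le.1 (h1 u)).2]

/-- Second order Taylor estimate for `φ` when `|φ''| ≤ ε φ'` and `|φ''| ≤ M`. -/
theorem abs_sub_sub_le_of_abs_deriv_le {ε M : ℝ} (hε : 0 ≤ ε) {φ p p' : ℝ → ℝ}
    (hφ : ∀ t, HasDerivAt φ (p t) t) (hp : ∀ t, HasDerivAt p (p' t) t)
    (hM : ∀ t, |p' t| ≤ M) (hpp : ∀ t, |p' t| ≤ ε * p t) (b y : ℝ) :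
    |φ (b + y) - φ b - p b * y| ≤ ε * (p b / 2 * |y| ^ 2 + M / 6 * |y| ^ 3) := by
  refine abs_le_comp_abs_of_abs_deriv_le (g := fun u => φ (b + u) - φ b - p b * u)
      (g' := fun u => p (b + u) - p b)
      (B := fun u => ε * (p b / 2 * u ^ 2 + M / 6 * u ^ 3))
      (B' := fun u => ε * (p b * u + M / 2 * u ^ 2))
      (fun u => ?_) (fun u => ?_) (by simp) (by simp)
      (fun u => abs_sub_le_of_abs_deriv_le hε hp hp hM hpp b u) y
  · exact ((((hφ (b + u)).comp_const_add b u).sub_const (φ b)).sub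
      ((hasDerivAt_id' u).const_mul (p b))).congr_deriv (by simp)
  · refine ((((hasDerivAt_pow 2 u).const_mul (p b / 2)).add
      ((hasDerivAt_pow 3 u).const_mul (M / 6))).const_mul ε).congr_deriv ?_
    norm_num
    left; ring

/-- The `n`-th term of the one-sided Fourier series has the norm of its coefficient. -/
theorem norm_mul_exp_I_mul (z : ℂ) (n : ℕ) (x : ℝ) :
    ‖z * Complex.exp (Complex.I * ((n : ℂ) + 1) * (x : ℂ))‖ = ‖z‖ := by
  have : Complex.I * ((n : ℂ) + 1) * (x : ℂ) = (((n + 1) * x : ℝ) : ℂ) * Complex.I := by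
    push_cast; ring
  rw [norm_mul, this, Complex.norm_exp_ofReal_mul_I, mul_one]

theorem summable_norm_of_summable_mul {c : ℕ → ℂ}
    (hc : Summable fun n : ℕ => ((n : ℝ) + 1) * ‖c n‖) : Summable fun n => ‖c n‖ :=
  Summable.of_nonneg_of_le (fun _ => norm_nonneg _)
    (fun n => by nlinarith [norm_nonneg (c n), (Nat.cast_nonneg n : (0 : ℝ) ≤ n)]) hc

section FourierSeries

variable {c : ℕ → ℂ} {s : ℝ → ℂ}

theorem bddAbove_range_norm_fourierSeries
    (hs : ∀ x, s x = ∑' n : ℕ, c n * Complex.exp (Complex.I * ((n : ℂ) + 1) * (x : ℂ)))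
    (hc : Summable fun n : ℕ => ((n : ℝ) + 1) * ‖c n‖) :
    BddAbove (Set.range fun x => ‖s x‖) := by
  refine ⟨∑' n, ‖c n‖, ?_⟩
  rintro _ ⟨x, rfl⟩
  simp only [hs x]
  exact tsum_of_norm_bounded (summable_norm_of_summable_mul hc).hasSum
    fun n => (norm_mul_exp_I_mul _ _ _).le

theorem norm_fourierSeries_sub_le
    (hs : ∀ x, s x = ∑' n : ℕ, c n * Complex.exp (Complex.I * ((n : ℂ) + 1) * (x : ℂ)))
    (hc : Summable fun n : ℕ => ((n : ℝ) + 1) * ‖c n‖) (x y : ℝ) :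
    ‖s x - s y‖ ≤ (∑' n : ℕ, ((n : ℝ) + 1) * ‖c n‖) * |x - y| := by
  have hsum : ∀ x : ℝ,
      Summable fun n : ℕ => c n * Complex.exp (Complex.I * ((n : ℂ) + 1) * (x : ℂ)) := fun x =>
    Summable.of_norm (by simpa only [norm_mul_exp_I_mul] using summable_norm_of_summable_mul hc)
  rw [hs x, hs y, ← (hsum x).tsum_sub (hsum y)]
  refine tsum_of_norm_bounded (hc.hasSum.mul_right _) fun n => ?_
  have e : c n * Complex.exp (Complex.I * ((n : ℂ) + 1) * (x : ℂ)) -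
      c n * Complex.exp (Complex.I * ((n : ℂ) + 1) * (y : ℂ)) =
      (c n * Complex.exp (Complex.I * ((n : ℂ) + 1) * (y : ℂ))) *
        (Complex.exp (Complex.I * (((n + 1) * (x - y) : ℝ) : ℂ)) - 1) := by
    rw [mul_sub, mul_assoc (c n), ← Complex.exp_add]
    push_cast
    ring_nf
  rw [e, norm_mul, norm_mul_exp_I_mul]
  have h := Real.norm_exp_I_mul_ofReal_sub_one_le (x := (n + 1) * (x - y))
  calc _ ≤ ‖c n‖ * ‖((n : ℝ) + 1) * (x - y)‖ := by gcongr
    _ = _ := by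
      rw [norm_mul, Real.norm_eq_abs, Real.norm_eq_abs, abs_of_nonneg (by positivity)]; ring

theorem continuous_fourierSeries
    (hs : ∀ x, s x = ∑' n : ℕ, c n * Complex.exp (Complex.I * ((n : ℂ) + 1) * (x : ℂ)))
    (hc : Summable fun n : ℕ => ((n : ℝ) + 1) * ‖c n‖) : Continuous s := by
  refine (LipschitzWith.of_dist_le_mul
    (K := ⟨∑' n : ℕ, ((n : ℝ) + 1) * ‖c n‖, tsum_nonneg fun n => by positivity⟩)
    fun x y => ?_).continuous
  rw [dist_eq_norm, Real.dist_eq]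
  exact norm_fourierSeries_sub_le hs hc x y

/-- Pairing a Fourier series along a linear phase with `ψ` only sees the harmonics `n + 1 > D` when
the Fourier transform of `ψ` vanishes at the others. -/
theorem norm_integral_fourierSeries_mul_conj_le
    (hs : ∀ x, s x = ∑' n : ℕ, c n * Complex.exp (Complex.I * ((n : ℂ) + 1) * (x : ℂ)))
    (hc : Summable fun n : ℕ => ((n : ℝ) + 1) * ‖c n‖) {D : ℕ} {ψ : ℝ → ℂ} (hψ : Integrable ψ)
    {α β : ℝ}
    (h0 : ∀ n < D, ∫ t : ℝ, ψ t * Complex.exp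
      (-(2 * (π : ℂ) * Complex.I * (t : ℂ) * ((((n : ℝ) + 1) * β : ℝ) : ℂ))) = 0) :
    ‖∫ x : ℝ, s (2 * π * (α + β * x)) * starRingEnd ℂ (ψ x)‖ ≤
      (∑' m : ℕ, ((D : ℝ) + (m : ℝ) + 1) * ‖c (D + m)‖) * ∫ x, ‖ψ x‖ := by
  set J := ∫ x, ‖ψ x‖ with hJ
  have hJ0 : 0 ≤ J := integral_nonneg fun _ => norm_nonneg _
  let F : ℕ → ℝ → ℂ := fun n x =>
    c n * Complex.exp (Complex.I * ((n : ℂ) + 1) * ((2 * π * (α + β * x) : ℝ) : ℂ)) *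
      starRingEnd ℂ (ψ x)
  have hFn : ∀ n x, ‖F n x‖ = ‖c n‖ * ‖ψ x‖ := fun n x => by
    simp only [F, norm_mul _ (starRingEnd ℂ _), norm_mul_exp_I_mul, RCLike.norm_conj]
  have hψc : Integrable fun x => starRingEnd ℂ (ψ x) :=
    (Complex.conjCLE.toContinuousLinearMap.integrable_comp hψ :)
  have hFi : ∀ n, Integrable (F n) := fun n =>
    hψc.bdd_mul (c := ‖c n‖) (by fun_prop)
      (ae_of_all _ fun x => (norm_mul_exp_I_mul _ _ _).le)
  have hFs : Summable fun n => ∫ x, ‖F n x‖ := by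
    simp only [hFn, integral_const_mul]
    exact (summable_norm_of_summable_mul hc).mul_right _
  have e1 : ∀ x, s (2 * π * (α + β * x)) * starRingEnd ℂ (ψ x) = ∑' n, F n x := fun x => by
    rw [hs, ← tsum_mul_right]
  have hz : ∀ n < D, ∫ x, F n x = 0 := fun n hn => by
    have e : ∀ x, F n x =
        (c n * Complex.exp (Complex.I * ((n : ℂ) + 1) * ((2 * π * α : ℝ) : ℂ))) *
        starRingEnd ℂ (ψ x * Complex.exp
          (-(2 * (π : ℂ) * Complex.I * (x : ℂ) * ((((n : ℝ) + 1) * β : ℝ) : ℂ)))) := fun x => by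
      simp only [F, map_mul, ← Complex.exp_conj, map_neg, Complex.conj_ofReal, Complex.conj_I,
        map_ofNat]
      rw [mul_comm (starRingEnd ℂ (ψ x)), ← mul_assoc, mul_assoc (c n) (Complex.exp _)
        (Complex.exp _), ← Complex.exp_add]
      push_cast
      ring_nf
    simp only [e]
    rw [integral_const_mul, integral_conj, h0 n hn, map_zero, mul_zero]
  simp only [e1]
  rw [← integral_tsum_of_summable_integral_norm hFi hFs,
    ← (hasSum_integral_of_summable_integral_norm hFi hFs).summable.sum_add_tsum_nat_add D,
    Finset.sum_eq_zero (fun n hn => hz n (Finset.mem_range.1 hn)), zero_add]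
  have hsD : Summable fun m : ℕ => ((D : ℝ) + (m : ℝ) + 1) * ‖c (D + m)‖ := by
    have := (summable_nat_add_iff D).2 hc
    refine this.congr fun m => ?_
    rw [add_comm m D]; push_cast; ring
  refine tsum_of_norm_bounded (hsD.hasSum.mul_right J) fun m => ?_
  calc ‖∫ x, F (m + D) x‖ ≤ ∫ x, ‖F (m + D) x‖ := norm_integral_le_integral_norm _
    _ = ‖c (D + m)‖ * J := by simp only [hFn, integral_const_mul, hJ, add_comm m D]
    _ ≤ _ := by
      gcongr
      have : (0 : ℝ) ≤ D + m := by positivity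
      nlinarith [norm_nonneg (c (D + m))]

end FourierSeries

/-- The Fourier transform of an integrable function supported in a closed interval also vanishes at
its endpoints. -/
theorem fourier_eq_zero_of_le_abs_sub {ψ Fψ : ℝ → ℂ} {Δ : ℝ} (hψ : Integrable ψ)
    (hFψ : ∀ ξ : ℝ, Fψ ξ =
      ∫ t : ℝ, ψ t * Complex.exp (-(2 * (π : ℂ) * Complex.I * (t : ℂ) * (ξ : ℂ))))
    (hsupp : ∀ ξ : ℝ, Fψ ξ ≠ 0 → ξ ∈ Set.Icc (1 - Δ) (1 + Δ)) {ξ : ℝ} (hξ : Δ ≤ |ξ - 1|) :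
    Fψ ξ = 0 := by
  have hn : ∀ ξ t : ℝ,
      ‖Complex.exp (-(2 * (π : ℂ) * Complex.I * (t : ℂ) * (ξ : ℂ)))‖ = 1 := fun ξ t => by
    have : -(2 * (π : ℂ) * Complex.I * (t : ℂ) * (ξ : ℂ)) =
        ((-(2 * π * t * ξ) : ℝ) : ℂ) * Complex.I := by push_cast; ring
    rw [this, Complex.norm_exp_ofReal_mul_I]
  have hcont : Continuous Fψ := by
    rw [funext hFψ]
    refine continuous_of_dominated (bound := fun t => ‖ψ t‖) (fun ξ => ?_) (fun ξ => ?_) hψ.norm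
      (ae_of_all _ fun t => by fun_prop)
    · exact hψ.aestronglyMeasurable.mul (by fun_prop)
    · exact ae_of_all _ fun t => by rw [norm_mul, hn, mul_one]
  by_contra hne
  have hop : IsOpen {ξ | Fψ ξ ≠ 0} := isOpen_ne_fun hcont continuous_const
  have := interior_maximal (show {ξ | Fψ ξ ≠ 0} ⊆ Set.Icc (1 - Δ) (1 + Δ) from hsupp) hop hne
  rw [interior_Icc] at this
  exact absurd hξ (not_le.2 (abs_lt.2 ⟨by linarith [this.1], by linarith [this.2]⟩))

/-- Near `b`, a component `A · s(2πφ)` is close to the one with frozen amplitude and linear phase. -/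
theorem norm_mul_sub_mul_linear_le {ε M S L : ℝ} (hε : 0 ≤ ε) {A A' φ p p' : ℝ → ℝ} {s : ℝ → ℂ}
    (hA : ∀ t, HasDerivAt A (A' t) t) (hφ : ∀ t, HasDerivAt φ (p t) t)
    (hp : ∀ t, HasDerivAt p (p' t) t) (hM : ∀ t, |p' t| ≤ M) (hAp : ∀ t, |A' t| ≤ ε * p t)
    (hpp : ∀ t, |p' t| ≤ ε * p t) (hApos : ∀ t, 0 < A t) (hS : ∀ x, ‖s x‖ ≤ S) (hL : 0 ≤ L)
    (hsL : ∀ x y, ‖s x - s y‖ ≤ L * |x - y|) (b y : ℝ) :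
    ‖(A (b + y) : ℂ) * s (2 * π * φ (b + y)) - (A b : ℂ) * s (2 * π * (φ b + p b * y))‖ ≤
      ε * (S * (p b * |y| + M / 2 * |y| ^ 2) +
        π * A b * L * (p b * |y| ^ 2 + M / 3 * |y| ^ 3)) := by
  have e : (A (b + y) : ℂ) * s (2 * π * φ (b + y)) - (A b : ℂ) * s (2 * π * (φ b + p b * y)) =
      ((A (b + y) - A b : ℝ) : ℂ) * s (2 * π * φ (b + y)) +
      (A b : ℂ) * (s (2 * π * φ (b + y)) - s (2 * π * (φ b + p b * y))) := by
    push_cast; ring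
  have hS0 : 0 ≤ S := (norm_nonneg _).trans (hS 0)
  have h1 := abs_sub_le_of_abs_deriv_le hε hA hp hM hAp b y
  have h2 := abs_sub_sub_le_of_abs_deriv_le hε hφ hp hM hpp b y
  have h3 := hsL (2 * π * φ (b + y)) (2 * π * (φ b + p b * y))
  have h4 : |2 * π * φ (b + y) - 2 * π * (φ b + p b * y)| ≤
      2 * π * (ε * (p b / 2 * |y| ^ 2 + M / 6 * |y| ^ 3)) := by
    rw [← mul_sub, abs_mul, abs_of_pos Real.two_pi_pos, ← sub_sub]
    gcongr
  rw [e]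
  refine (norm_add_le _ _).trans ?_
  rw [norm_mul, norm_mul, Complex.norm_real, Complex.norm_real, Real.norm_eq_abs, Real.norm_eq_abs,
    abs_of_pos (hApos b)]
  calc _ ≤ ε * (p b * |y| + M / 2 * |y| ^ 2) * S +
        A b * (L * (2 * π * (ε * (p b / 2 * |y| ^ 2 + M / 6 * |y| ^ 3)))) := by
        gcongr
        · exact (abs_nonneg _).trans h1
        · exact hS _
        · exact (hApos b).le
        · exact h3.trans (by gcongr)
    _ = _ := by ring

theorem integrable_comp_affine_mul_conj {g ψ : ℝ → ℂ} {C : ℝ} (hg : Continuous g)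
    (hC : ∀ t, ‖g t‖ ≤ C) (hψ : Integrable ψ) (a b : ℝ) :
    Integrable fun x => g (b + a * x) * starRingEnd ℂ (ψ x) :=
  Integrable.bdd_mul (c := C) (g := fun x => starRingEnd ℂ (ψ x))
    (Complex.conjCLE.toContinuousLinearMap.integrable_comp hψ :)
    (hg.comp (by fun_prop)).aestronglyMeasurable (ae_of_all _ fun _ => hC _)

/-- If `g` is close to `h` up to an error cubic in the displacement, then pairing with `ψ` costs the
corresponding absolute moments of `ψ`. -/
theorem norm_integral_mul_conj_le_of_norm_sub_le {G H : ℝ → ℂ} (ψ : SchwartzMap ℝ ℂ)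
    {q1 q2 q3 : ℝ} (hG : Integrable fun x => G x * starRingEnd ℂ (ψ x))
    (hH : Integrable fun x => H x * starRingEnd ℂ (ψ x))
    (h : ∀ x, ‖G x - H x‖ ≤ q1 * |x| + q2 * |x| ^ 2 + q3 * |x| ^ 3) :
    ‖∫ x, G x * starRingEnd ℂ (ψ x)‖ ≤
      (q1 * (∫ x, |x| * ‖ψ x‖) + q2 * (∫ x, |x| ^ 2 * ‖ψ x‖) + q3 * (∫ x, |x| ^ 3 * ‖ψ x‖)) +
        ‖∫ x, H x * starRingEnd ℂ (ψ x)‖ := by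
  have hi : ∀ k : ℕ, Integrable fun x : ℝ => |x| ^ k * ‖ψ x‖ := fun k => by
    simpa using ψ.integrable_pow_mul volume k
  have hi1 : Integrable fun x : ℝ => |x| * ‖ψ x‖ := by simpa using hi 1
  have e : ∫ x, G x * starRingEnd ℂ (ψ x) =
      (∫ x, (G x * starRingEnd ℂ (ψ x) - H x * starRingEnd ℂ (ψ x))) +
        ∫ x, H x * starRingEnd ℂ (ψ x) := by
    rw [integral_sub hG hH, sub_add_cancel]
  rw [e]
  refine (norm_add_le _ _).trans (add_le_add_left ?_ _)
  rw [← integral_const_mul, ← integral_const_mul, ← integral_const_mul,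
    ← integral_add (hi1.const_mul _) ((hi 2).const_mul _),
    ← integral_add (by exact (hi1.const_mul _).add ((hi 2).const_mul _)) ((hi 3).const_mul _)]
  refine norm_integral_le_of_norm_le
    (((hi1.const_mul _).add ((hi 2).const_mul _)).add ((hi 3).const_mul _))
    (ae_of_all _ fun x => ?_)
  rw [← sub_mul, norm_mul, RCLike.norm_conj]
  calc _ ≤ (q1 * |x| + q2 * |x| ^ 2 + q3 * |x| ^ 3) * ‖ψ x‖ := by gcongr; exact h x
    _ = _ := by ring

/-- Rescaling the wavelet integral to the unit scale. -/
theorem wavelet_integral_eq_sqrt_mul (f ψ : ℝ → ℂ) {a : ℝ} (ha : 0 < a) (b : ℝ) :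
    ∫ t : ℝ, f t * ((Real.sqrt a : ℂ))⁻¹ * starRingEnd ℂ (ψ ((t - b) / a)) =
      (Real.sqrt a : ℂ) * ∫ x : ℝ, f (b + a * x) * starRingEnd ℂ (ψ x) := by
  set g : ℝ → ℂ := fun t => f t * ((Real.sqrt a : ℂ))⁻¹ * starRingEnd ℂ (ψ ((t - b) / a)) with hg
  have h1 : ∫ x : ℝ, g (b + a * x) = |a⁻¹| • ∫ t, g t := by
    rw [Measure.integral_comp_mul_left (fun t => g (b + t)) a, integral_add_left_eq_self]
  have h2 : ∀ x, g (b + a * x) =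
      ((Real.sqrt a : ℂ))⁻¹ * (f (b + a * x) * starRingEnd ℂ (ψ x)) := fun x => by
    simp only [hg, add_sub_cancel_left, mul_div_cancel_left₀ x ha.ne']
    ring
  simp only [h2, integral_const_mul] at h1
  have hs : (Real.sqrt a : ℂ) ≠ 0 := by exact_mod_cast (Real.sqrt_pos.2 ha).ne'
  have hss : (Real.sqrt a : ℂ) * (Real.sqrt a : ℂ) = (a : ℂ) := by
    exact_mod_cast Real.mul_self_sqrt ha.le
  have ha' : (a : ℂ) ≠ 0 := by exact_mod_cast ha.ne'
  rw [abs_of_pos (inv_pos.2 ha), Complex.real_smul, Complex.ofReal_inv, ← hss] at h1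
  field_simp at h1
  rw [← h1]

/-- Away from all bands `{|a n φ'_k(b) − 1| < Δ}`, the wavelet transform of
`f(t) = Σ_{k=1}^K A_k(t) s_k(2π φ_k(t))` is small:
`|W_f(a,b)| ≤ ε a^{1/2} Σ_k [ (sup|s_k|)(φ'_k(b) a I₁ + (M''_k/2) a² I₂)
  + π A_k(b) (Σ_j j|c_{k,j}|)(a² I₂ φ'_k(b) + (M''_k/3) a³ I₃) + I₀ A_k(b) ]`. -/
theorem statement8
    (ε Δ : ℝ) (K D : ℕ)
    (hε : 0 < ε) (hΔ : Δ ∈ Set.Ioo (0 : ℝ) 1)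
    (hK : 1 ≤ K) (hD : 1 ≤ D)
    (ψ : SchwartzMap ℝ ℂ)
    (Fψ : ℝ → ℂ)
    (hFψ : ∀ ξ : ℝ, Fψ ξ =
      ∫ t : ℝ, ψ t * Complex.exp (-(2 * (π : ℂ) * Complex.I * (t : ℂ) * (ξ : ℂ))))
    (hFψsupp : ∀ ξ : ℝ, Fψ ξ ≠ 0 → ξ ∈ Set.Icc (1 - Δ) (1 + Δ))
    (I0 I1 I2 I3 : ℝ)
    (hI0 : I0 = ∫ x : ℝ, ‖ψ x‖) (hI1 : I1 = ∫ x : ℝ, |x| * ‖ψ x‖)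
    (hI2 : I2 = ∫ x : ℝ, |x| ^ 2 * ‖ψ x‖) (hI3 : I3 = ∫ x : ℝ, |x| ^ 3 * ‖ψ x‖)
    (c : ℕ → ℕ → ℂ) (s : ℕ → ℝ → ℂ)
    (hs : ∀ k x, s k x = ∑' n : ℕ, c k (n + 1) * Complex.exp (Complex.I * ((n : ℂ) + 1) * (x : ℂ)))
    (hc : ∀ k, Summable fun n : ℕ => ((n : ℝ) + 1) * ‖c k (n + 1)‖)
    (hcD : ∀ k, 1 ≤ k → k ≤ K →
      (∑' m : ℕ, ((D : ℝ) + (m : ℝ) + 1) * ‖c k (D + m + 1)‖) ≤ ε)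
    (A φ : ℕ → ℝ → ℝ)
    (hA : ∀ k, ContDiff ℝ 1 (A k))
    (hApos : ∀ k t, 0 < A k t)
    (hAsup : ∀ k, ∃ C, ∀ t, A k t ≤ C)
    (hφ : ∀ k, ContDiff ℝ 2 (φ k))
    (hφ' : ∀ k t, 0 < deriv (φ k) t)
    (M'' : ℕ → ℝ)
    (hM'' : ∀ k, M'' k = ⨆ t, |deriv (deriv (φ k)) t|)
    (hM''bdd : ∀ k, BddAbove (Set.range fun t => |deriv (deriv (φ k)) t|))
    (hA' : ∀ k, 1 ≤ k → k ≤ K → ∀ t, |deriv (A k) t| ≤ ε * deriv (φ k) t)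
    (hφ'' : ∀ k, 1 ≤ k → k ≤ K → ∀ t, |deriv (deriv (φ k)) t| ≤ ε * deriv (φ k) t)
    (f : ℝ → ℂ)
    (hf : ∀ t, f t = ∑ k ∈ Finset.Icc 1 K, (A k t : ℂ) * s k (2 * π * φ k t))
    (W : ℝ → ℝ → ℂ)
    (hW : ∀ a b : ℝ, W a b =
      ∫ t : ℝ, f t * ((Real.sqrt a : ℂ))⁻¹ * starRingEnd ℂ (ψ ((t - b) / a))) :
    ∀ a b : ℝ, 0 < a →
      (∀ k n : ℕ, 1 ≤ k → k ≤ K → 1 ≤ n → n ≤ D →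
        Δ ≤ |a * n * deriv (φ k) b - 1|) →
      ‖W a b‖ ≤
        ε * Real.sqrt a *
          ∑ k ∈ Finset.Icc 1 K,
            ((⨆ x, ‖s k x‖) * (deriv (φ k) b * a * I1 + M'' k / 2 * a ^ 2 * I2) +
              π * A k b * (∑' j : ℕ, ((j : ℝ) + 1) * ‖c k (j + 1)‖) *
                (a ^ 2 * I2 * deriv (φ k) b + M'' k / 3 * a ^ 3 * I3) +
              I0 * A k b) := by
  intro a b ha hab
  have hψ : Integrable ψ := ψ.integrable
  have hI00 : 0 ≤ I0 := hI0 ▸ integral_nonneg fun _ => norm_nonneg _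
  have dA : ∀ k t, HasDerivAt (A k) (deriv (A k) t) t := fun k t =>
    ((hA k).differentiable one_ne_zero t).hasDerivAt
  have dφ : ∀ k t, HasDerivAt (φ k) (deriv (φ k) t) t := fun k t =>
    ((hφ k).differentiable two_ne_zero t).hasDerivAt
  have dφ' : ∀ k t, HasDerivAt (deriv (φ k)) (deriv (deriv (φ k)) t) t := fun k t =>
    (((contDiff_succ_iff_deriv (n := 1)).1 (hφ k)).2.2.differentiable one_ne_zero t).hasDerivAt
  have hM : ∀ k t, |deriv (deriv (φ k)) t| ≤ M'' k := fun k t =>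
    hM'' k ▸ le_ciSup (hM''bdd k) t
  have hS : ∀ k x, ‖s k x‖ ≤ ⨆ x, ‖s k x‖ := fun k x =>
    le_ciSup (bddAbove_range_norm_fourierSeries (hs k) (hc k)) x
  have hsc : ∀ k, Continuous (s k) := fun k => continuous_fourierSeries (hs k) (hc k)
  have hint : ∀ k, Integrable fun x =>
      ((A k (b + a * x) : ℂ) * s k (2 * π * φ k (b + a * x))) * starRingEnd ℂ (ψ x) := fun k => by
    obtain ⟨C, hC⟩ := hAsup k
    have hAc := (hA k).continuous
    have hφc := (hφ k).continuous
    have hsk := hsc k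
    refine integrable_comp_affine_mul_conj (C := C * ⨆ x, ‖s k x‖)
      (g := fun t => (A k t : ℂ) * s k (2 * π * φ k t)) (by fun_prop) (fun t => ?_) hψ a b
    rw [norm_mul, Complex.norm_real, Real.norm_eq_abs, abs_of_pos (hApos k t)]
    exact mul_le_mul (hC t) (hS k _) (norm_nonneg _) ((hApos k t).le.trans (hC t))
  rw [hW, wavelet_integral_eq_sqrt_mul f ψ ha b, norm_mul, Complex.norm_real, Real.norm_eq_abs,
    abs_of_nonneg (Real.sqrt_nonneg a), mul_comm ε, mul_assoc]
  refine mul_le_mul_of_nonneg_left ?_ (Real.sqrt_nonneg a)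
  simp only [hf, Finset.sum_mul]
  rw [integral_finsetSum _ fun k _ => hint k, Finset.mul_sum]
  refine (norm_sum_le _ _).trans (Finset.sum_le_sum fun k hk => ?_)
  obtain ⟨hk1, hkK⟩ := Finset.mem_Icc.1 hk
  set L := ∑' j : ℕ, ((j : ℝ) + 1) * ‖c k (j + 1)‖
  set S := ⨆ x, ‖s k x‖
  have hlin : ‖∫ x, ((A k b : ℂ) * s k (2 * π * (φ k b + deriv (φ k) b * (a * x)))) *
      starRingEnd ℂ (ψ x)‖ ≤ A k b * (ε * I0) := by
    have h := norm_integral_fourierSeries_mul_conj_le (hs k) (hc k) (D := D) hψ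
      (α := φ k b) (β := deriv (φ k) b * a) fun n hn => by
        rw [← hFψ]
        refine fourier_eq_zero_of_le_abs_sub hψ hFψ hFψsupp ?_
        have := hab k (n + 1) hk1 hkK (by omega) (by omega)
        push_cast at this
        convert this using 3
        ring
    simp only [mul_assoc (A k b : ℂ), ← mul_assoc (deriv (φ k) b)]
    rw [integral_const_mul, norm_mul, Complex.norm_real, Real.norm_eq_abs, abs_of_pos (hApos k b)]
    rw [← hI0] at h
    exact mul_le_mul_of_nonneg_left
      (h.trans (mul_le_mul_of_nonneg_right (hcD k hk1 hkK) hI00)) (hApos k b).le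
  have hH : Integrable fun x => ((A k b : ℂ) * s k (2 * π * (φ k b + deriv (φ k) b * (a * x)))) *
      starRingEnd ℂ (ψ x) := by
    have hsk := hsc k
    refine (integrable_comp_affine_mul_conj (C := A k b * S)
      (g := fun t => (A k b : ℂ) * s k (2 * π * (φ k b + deriv (φ k) b * t))) (by fun_prop)
      (fun t => ?_) hψ a 0).congr (ae_of_all _ fun x => by simp)
    rw [norm_mul, Complex.norm_real, Real.norm_eq_abs, abs_of_pos (hApos k b)]
    exact mul_le_mul_of_nonneg_left (hS k _) (hApos k b).le
  refine (norm_integral_mul_conj_le_of_norm_sub_le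
    (q1 := ε * (S * (deriv (φ k) b * a)))
    (q2 := ε * (S * (M'' k / 2 * a ^ 2) + π * A k b * L * (deriv (φ k) b * a ^ 2)))
    (q3 := ε * (π * A k b * L * (M'' k / 3 * a ^ 3))) ψ (hint k) hH fun x => ?_).trans ?_
  · refine (norm_mul_sub_mul_linear_le hε.le (dA k) (dφ k) (dφ' k) (hM k) (hA' k hk1 hkK)
      (hφ'' k hk1 hkK) (hApos k) (hS k) (tsum_nonneg fun n => by positivity)
      (norm_fourierSeries_sub_le (hs k) (hc k)) b (a * x)).trans_eq ?_
    rw [abs_mul, abs_of_pos ha]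
    ring
  · rw [← hI1, ← hI2, ← hI3]
    refine (add_le_add_right hlin _).trans_eq ?_
    ring
end

section
/- Let ψ : ℝ → ℂ be a Schwartz function with Fourier transform ψ̂(ξ) = ∫_ℝ ψ(t) e^{−2πi t ξ} dt, let (c_n)_{n≥1} ⊂ ℂ satisfy Σ_{n=1}^∞ n |c_n| < ∞, and set s(x) = Σ_{n=1}^∞ c_n e^{i n x}. Then for all μ > 0, θ ∈ ℝ, a > 0 and b ∈ ℝ: ∫_ℝ s(2π μ t + θ) a^{−3/2} conj(ψ'((t−b)/a)) dt = −2πi a^{1/2} Σ_{n=1}^∞ n c_n μ e^{i (2π n μ b + n θ)} conj(ψ̂(a n μ)). -/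
open Real MeasureTheory

/-- The Fourier transform of the derivative of a Schwartz function, in integral form. -/
theorem SchwartzMap.integral_deriv_mul_exp (ψ : SchwartzMap ℝ ℂ) (ξ : ℝ) :
    (∫ t : ℝ, deriv ψ t * Complex.exp (-(2 * (π : ℂ) * Complex.I * (t : ℂ) * (ξ : ℂ)))) =
      2 * (π : ℂ) * Complex.I * ξ *
        ∫ t : ℝ, ψ t * Complex.exp (-(2 * (π : ℂ) * Complex.I * (t : ℂ) * (ξ : ℂ))) := by
  have h := congrFun (Real.fourier_deriv (f := ψ) ψ.integrable ψ.differentiable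
    (SchwartzMap.derivCLM ℝ ℂ ψ).integrable) ξ
  simp only [Real.fourier_real_eq_integral_exp_smul, smul_eq_mul] at h
  have hexp (t : ℝ) : Complex.exp (((-2 * π * t * ξ : ℝ) : ℂ) * Complex.I) =
      Complex.exp (-(2 * (π : ℂ) * Complex.I * (t : ℂ) * (ξ : ℂ))) := by
    congr 1; push_cast; ring
  simpa only [hexp, mul_comm (Complex.exp _)] using h

/-- The correlation of a complex exponential with a rescaled derivative of a Schwartz function. -/
theorem SchwartzMap.integral_exp_mul_conj_deriv (ψ : SchwartzMap ℝ ℂ) (w μ θ b : ℝ) {a : ℝ}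
    (ha : 0 < a) :
    (∫ t : ℝ, Complex.exp (Complex.I * w * ((2 * π * μ * t + θ : ℝ) : ℂ)) *
        starRingEnd ℂ (deriv ψ ((t - b) / a))) =
      -(2 * (π : ℂ) * Complex.I) * a ^ 2 * w * μ *
        Complex.exp (Complex.I * ((2 * π * w * μ * b + w * θ : ℝ) : ℂ)) *
        starRingEnd ℂ (∫ t : ℝ, ψ t *
          Complex.exp (-(2 * (π : ℂ) * Complex.I * (t : ℂ) * ((a * w * μ : ℝ) : ℂ)))) := by
  set g : ℝ → ℂ := fun u => Complex.exp (Complex.I * ((2 * π * w * μ * b + w * θ : ℝ) : ℂ)) *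
    starRingEnd ℂ (deriv ψ u *
      Complex.exp (-(2 * (π : ℂ) * Complex.I * (u : ℂ) * ((a * w * μ : ℝ) : ℂ)))) with hg
  have hgt (t : ℝ) : Complex.exp (Complex.I * w * ((2 * π * μ * t + θ : ℝ) : ℂ)) *
      starRingEnd ℂ (deriv ψ ((t - b) / a)) = g ((t - b) / a) := by
    have ha' : (a : ℂ) ≠ 0 := by exact_mod_cast ha.ne'
    simp only [hg, map_mul, ← Complex.exp_conj]
    rw [mul_comm (starRingEnd ℂ (deriv ψ _)), ← mul_assoc, ← Complex.exp_add]
    congr 2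
    simp only [map_neg, map_mul, Complex.conj_ofReal, Complex.conj_I, map_ofNat]
    push_cast
    field_simp
    ring
  simp_rw [hgt]
  rw [integral_sub_right_eq_self (fun t => g (t / a)) b, Measure.integral_comp_div g a, hg,
    integral_const_mul, integral_conj, ψ.integral_deriv_mul_exp, abs_of_pos ha]
  simp only [map_mul, Complex.conj_ofReal, Complex.conj_I, map_ofNat, Complex.real_smul]
  push_cast
  ring

/-- For a Schwartz function `ψ`, summable `Σ n |c_n| < ∞`,
`s(x) = Σ_{n≥1} c_n e^{inx}`, for all `μ > 0`, `θ ∈ ℝ`, `a > 0`, `b ∈ ℝ`: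
`∫ s(2πμt + θ) a^{−3/2} conj(ψ'((t−b)/a)) dt
  = −2πi a^{1/2} Σ_{n≥1} n c_n μ e^{i(2πnμb + nθ)} conj(ψ̂(a n μ))`. -/
theorem statement9 (ψ : SchwartzMap ℝ ℂ) (c : ℕ → ℂ)
    (hc : Summable fun n : ℕ => ((n : ℝ) + 1) * ‖c (n + 1)‖)
    (s : ℝ → ℂ)
    (hs : ∀ x : ℝ, s x = ∑' n : ℕ, c (n + 1) * Complex.exp (Complex.I * ((n : ℂ) + 1) * (x : ℂ)))
    (Fψ : ℝ → ℂ)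
    (hFψ : ∀ ξ : ℝ, Fψ ξ =
      ∫ t : ℝ, ψ t * Complex.exp (-(2 * (π : ℂ) * Complex.I * (t : ℂ) * (ξ : ℂ)))) :
    ∀ μ θ : ℝ, 0 < μ → ∀ a b : ℝ, 0 < a →
      (∫ t : ℝ, s (2 * π * μ * t + θ) * ((a ^ ((3 : ℝ) / 2) : ℝ) : ℂ)⁻¹ *
          starRingEnd ℂ (deriv (⇑ψ) ((t - b) / a))) =
        -(2 * (π : ℂ) * Complex.I) * (Real.sqrt a : ℂ) *
          ∑' n : ℕ, ((n : ℂ) + 1) * c (n + 1) * (μ : ℂ) *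
            Complex.exp (Complex.I * ((2 * π * ((n : ℝ) + 1) * μ * b + ((n : ℝ) + 1) * θ : ℝ) : ℂ)) *
            starRingEnd ℂ (Fψ (a * ((n : ℝ) + 1) * μ)) := by
  intro μ θ _ a b ha
  set K : ℂ := ((a ^ ((3 : ℝ) / 2) : ℝ) : ℂ)⁻¹ with hK
  have hKa : K * (a : ℂ) ^ 2 = (Real.sqrt a : ℂ) := by
    have h : a ^ ((3 : ℝ) / 2) * Real.sqrt a = a ^ 2 := by
      rw [Real.sqrt_eq_rpow, ← Real.rpow_add ha]
      norm_num
    have h0 : ((a ^ ((3 : ℝ) / 2) : ℝ) : ℂ) ≠ 0 := by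
      exact_mod_cast (Real.rpow_pos_of_pos ha _).ne'
    rw [hK, inv_mul_eq_iff_eq_mul₀ h0]
    exact_mod_cast h.symm
  set d : ℝ → ℂ := fun t => starRingEnd ℂ (deriv (⇑ψ) ((t - b) / a)) with hd
  have hd_int : Integrable d := by
    have h : Integrable (deriv ψ) := (SchwartzMap.derivCLM ℝ ℂ ψ).integrable
    exact Complex.conjCLE.toContinuousLinearMap.integrable_comp
      ((h.comp_div ha.ne').comp_sub_right b)
  set e : ℕ → ℝ → ℂ := fun n t =>
    Complex.exp (Complex.I * ((n : ℂ) + 1) * ((2 * π * μ * t + θ : ℝ) : ℂ)) with he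
  have he_norm (n : ℕ) (t : ℝ) : ‖e n t‖ = 1 := by
    simp only [he]
    rw [show Complex.I * ((n : ℂ) + 1) * ((2 * π * μ * t + θ : ℝ) : ℂ) =
      ((((n : ℝ) + 1) * (2 * π * μ * t + θ) : ℝ) : ℂ) * Complex.I by push_cast; ring]
    exact Complex.norm_exp_ofReal_mul_I _
  have he_cont (n : ℕ) : Continuous (e n) := by
    simp only [he]
    fun_prop
  have hF_int (n : ℕ) : Integrable fun t => c (n + 1) * K * (e n t * d t) :=
    (hd_int.bdd_mul (he_cont n).aestronglyMeasurable
      (Filter.Eventually.of_forall fun t => (he_norm n t).le)).const_mul _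
  have hc_norm : Summable fun n : ℕ => ‖c (n + 1)‖ :=
    hc.of_nonneg_of_le (fun _ => norm_nonneg _) fun n =>
      le_mul_of_one_le_left (norm_nonneg _) (by linarith [n.cast_nonneg (α := ℝ)])
  have hF_sum : Summable fun n : ℕ => ∫ t, ‖c (n + 1) * K * (e n t * d t)‖ := by
    simp only [norm_mul, he_norm, one_mul, integral_const_mul]
    exact (hc_norm.mul_right _).mul_right _
  have hlhs (t : ℝ) : s (2 * π * μ * t + θ) * K * d t =
      ∑' n : ℕ, c (n + 1) * K * (e n t * d t) := by
    rw [hs, mul_assoc, ← tsum_mul_right]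
    exact tsum_congr fun n => by simp only [he]; ring
  calc ∫ t, s (2 * π * μ * t + θ) * K * d t
      = ∑' n : ℕ, ∫ t, c (n + 1) * K * (e n t * d t) := by
        simp_rw [hlhs]
        exact (integral_tsum_of_summable_integral_norm hF_int hF_sum).symm
    _ = _ := by
        rw [← tsum_mul_left]
        refine tsum_congr fun n => ?_
        have h := ψ.integral_exp_mul_conj_deriv ((n : ℝ) + 1) μ θ b ha
        rw [← hFψ] at h
        rw [integral_const_mul, ← hKa]
        simp only [he, hd]
        push_cast at h ⊢
        rw [h]
        ring
end

section
/- Let A ⊆ (0,∞) be a Lebesgue measurable set, let g : (0,∞) → ℂ be measurable with a ↦ g(a) a^{−3/2} integrable on A, let ω : (0,∞) → ℝ be measurable, and let Ξ ⊆ ℝ be an open set such that {a ∈ A : ω(a) ∈ ∂Ξ} has Lebesgue measure zero, where ∂Ξ denotes the topological frontier of Ξ. Set h(t) = π^{−1/2} e^{−t²}. Then lim_{α → 0⁺} ∫_Ξ ( ∫_A g(a) α^{−1} h(|ξ − ω(a)|/α) a^{−3/2} da ) dξ = ∫_{A ∩ {a : ω(a) ∈ Ξ}} g(a) a^{−3/2}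 da. -/
open Real MeasureTheory

open Filter Topology

theorem integrable_rescaled_kernel {h : ℝ → ℝ} (hh : Integrable h) {α : ℝ} (hα : 0 < α) (w : ℝ) :
    Integrable (fun ξ => α⁻¹ * h ((ξ - w) / α)) :=
  ((hh.comp_div hα.ne').comp_sub_right w).const_mul _

theorem setIntegral_rescaled_kernel (h : ℝ → ℝ) {Ξ : Set ℝ} (hΞ : MeasurableSet Ξ) {α : ℝ}
    (hα : 0 < α) (w : ℝ) :
    ∫ ξ in Ξ, α⁻¹ * h ((ξ - w) / α) = ∫ t, Ξ.indicator 1 (w + α * t) * h t := by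
  have key : ∀ ξ, Ξ.indicator (fun ξ => α⁻¹ * h ((ξ - w) / α)) ξ =
      α⁻¹ * (Ξ.indicator 1 (w + α * ((ξ - w) / α)) * h ((ξ - w) / α)) := by
    intro ξ
    have : w + α * ((ξ - w) / α) = ξ := by field_simp; ring
    rw [this]
    by_cases hξ : ξ ∈ Ξ <;> simp [hξ]
  rw [← integral_indicator hΞ, integral_congr_ae (ae_of_all _ key), integral_const_mul,
    integral_sub_right_eq_self (fun x => Ξ.indicator 1 (w + α * (x / α)) * h (x / α)) w,
    Measure.integral_comp_div (fun t => Ξ.indicator 1 (w + α * t) * h t) α, abs_of_pos hα,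
    smul_eq_mul, inv_mul_cancel_left₀ hα.ne']

theorem integral_rescaled_kernel (h : ℝ → ℝ) {α : ℝ} (hα : 0 < α) (w : ℝ) :
    ∫ ξ, α⁻¹ * h ((ξ - w) / α) = ∫ t, h t := by
  simpa using setIntegral_rescaled_kernel h MeasurableSet.univ hα w

theorem tendsto_indicator_of_notMem_frontier {X : Type*} [TopologicalSpace X] {s : Set X} {x : X}
    (hx : x ∉ frontier s) :
    Tendsto (s.indicator (1 : X → ℝ)) (𝓝 x) (𝓝 (s.indicator 1 x)) :=
  ((continuousOn_const (c := (1 : ℝ))).continuousAt_indicator hx).tendsto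

theorem tendsto_setIntegral_rescaled_kernel {h : ℝ → ℝ} (hh : Integrable h) {Ξ : Set ℝ}
    (hΞ : MeasurableSet Ξ) {w : ℝ} (hw : w ∉ frontier Ξ) :
    Tendsto (fun α => ∫ ξ in Ξ, α⁻¹ * h ((ξ - w) / α)) (𝓝[>] 0)
      (𝓝 (Ξ.indicator 1 w * ∫ t, h t)) := by
  have hlim : Tendsto (fun α => ∫ t, Ξ.indicator 1 (w + α * t) * h t) (𝓝[>] (0 : ℝ))
      (𝓝 (∫ t, Ξ.indicator 1 w * h t)) := by
    refine tendsto_integral_filter_of_dominated_convergence (fun t => ‖h t‖)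
      (Eventually.of_forall fun α => ?_) (Eventually.of_forall fun α => ae_of_all _ fun t => ?_)
      hh.norm (ae_of_all _ fun t => ?_)
    · exact ((measurable_one.indicator hΞ).comp (by fun_prop)).aestronglyMeasurable.mul
        hh.aestronglyMeasurable
    · by_cases hξ : w + α * t ∈ Ξ <;> simp [hξ]
    · refine Tendsto.mul_const _ ?_
      refine (tendsto_indicator_of_notMem_frontier hw).comp ?_
      have : Tendsto (fun α : ℝ => w + α * t) (𝓝 0) (𝓝 (w + 0 * t)) :=
        Continuous.tendsto (by fun_prop) 0
      rw [zero_mul, add_zero] at this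
      exact this.mono_left nhdsWithin_le_nhds
  rw [integral_const_mul] at hlim
  refine hlim.congr' ?_
  filter_upwards [self_mem_nhdsWithin] with α hα
  exact (setIntegral_rescaled_kernel h hΞ hα w).symm

theorem integrable_prod_rescaled_kernel {X : Type*} [MeasurableSpace X] {μ : Measure X} [SFinite μ]
    {h : ℝ → ℝ} (hm : Measurable h) (hh : Integrable h) {F : X → ℂ} (hF : Integrable F μ)
    {ω : X → ℝ} (hω : Measurable ω) {α : ℝ} (hα : 0 < α) :
    Integrable (fun p : ℝ × X => F p.2 * ((α⁻¹ * h ((p.1 - ω p.2) / α) : ℝ) : ℂ))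
      (volume.prod μ) := by
  have hk : Measurable fun p : ℝ × X => ((α⁻¹ * h ((p.1 - ω p.2) / α) : ℝ) : ℂ) := by fun_prop
  have hs : AEStronglyMeasurable
      (fun p : ℝ × X => F p.2 * ((α⁻¹ * h ((p.1 - ω p.2) / α) : ℝ) : ℂ)) (volume.prod μ) :=
    hF.aestronglyMeasurable.comp_snd.mul hk.aestronglyMeasurable
  refine (integrable_prod_iff' hs).2 ⟨ae_of_all _ fun a => ?_, ?_⟩
  · exact Integrable.const_mul (integrable_rescaled_kernel hh hα (ω a)).ofReal (F a)
  · have : ∀ a, ∫ ξ, ‖F a * ((α⁻¹ * h ((ξ - ω a) / α) : ℝ) : ℂ)‖ = ‖F a‖ * ∫ t, |h t| := by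
      intro a
      simp_rw [norm_mul, Complex.norm_real, norm_mul, Real.norm_eq_abs, abs_of_pos (inv_pos.2 hα)]
      rw [integral_const_mul, integral_rescaled_kernel (fun t => |h t|) hα]
    simp_rw [this]
    exact hF.norm.mul_const _

theorem tendsto_setIntegral_integral_rescaled_kernel {X : Type*} [MeasurableSpace X]
    {μ : Measure X} [SFinite μ] {h : ℝ → ℝ} (hm : Measurable h) (hh : Integrable h) {F : X → ℂ}
    (hF : Integrable F μ) {ω : X → ℝ} (hω : Measurable ω) {Ξ : Set ℝ} (hΞ : MeasurableSet Ξ)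
    (hfr : ∀ᵐ a ∂μ, ω a ∉ frontier Ξ) :
    Tendsto (fun α : ℝ => ∫ ξ in Ξ, ∫ a, F a * ((α⁻¹ * h ((ξ - ω a) / α) : ℝ) : ℂ) ∂μ) (𝓝[>] 0)
      (𝓝 ((∫ a in ω ⁻¹' Ξ, F a ∂μ) * ((∫ t, h t : ℝ) : ℂ))) := by
  have hlim : Tendsto
      (fun α : ℝ => ∫ a, F a * ((∫ ξ in Ξ, α⁻¹ * h ((ξ - ω a) / α) : ℝ) : ℂ) ∂μ) (𝓝[>] 0)
      (𝓝 (∫ a, F a * ((Ξ.indicator 1 (ω a) * ∫ t, h t : ℝ) : ℂ) ∂μ)) := by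
    refine tendsto_integral_filter_of_dominated_convergence (fun a => ‖F a‖ * ∫ t, |h t|)
      (Eventually.of_forall fun α => ?_) ?_ (hF.norm.mul_const _) ?_
    · have hk : Measurable fun p : X × ℝ => α⁻¹ * h ((p.2 - ω p.1) / α) := by fun_prop
      exact hF.aestronglyMeasurable.mul (Complex.continuous_ofReal.comp_aestronglyMeasurable
        (hk.stronglyMeasurable.integral_prod_right (ν := volume.restrict Ξ)).aestronglyMeasurable)
    · filter_upwards [self_mem_nhdsWithin] with α hα
      have hα : 0 < α := hα
      refine ae_of_all _ fun a => ?_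
      rw [norm_mul, Complex.norm_real]
      gcongr
      refine (norm_integral_le_integral_norm _).trans ?_
      refine (setIntegral_le_integral (integrable_rescaled_kernel hh hα (ω a)).norm
        (ae_of_all _ fun _ => norm_nonneg _)).trans_eq ?_
      simp_rw [norm_mul, Real.norm_eq_abs, abs_of_pos (inv_pos.2 hα)]
      exact integral_rescaled_kernel (fun t => |h t|) hα _
    · filter_upwards [hfr] with a ha
      exact ((Complex.continuous_ofReal.tendsto _).comp
        (tendsto_setIntegral_rescaled_kernel hh hΞ ha)).const_mul _
  have hval : ∫ a, F a * ((Ξ.indicator 1 (ω a) * ∫ t, h t : ℝ) : ℂ) ∂μ =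
      (∫ a in ω ⁻¹' Ξ, F a ∂μ) * ((∫ t, h t : ℝ) : ℂ) := by
    rw [← integral_indicator (hω hΞ), ← integral_mul_const]
    refine integral_congr_ae (ae_of_all _ fun a => ?_)
    by_cases ha : ω a ∈ Ξ <;> simp [ha]
  rw [hval] at hlim
  refine hlim.congr' ?_
  filter_upwards [self_mem_nhdsWithin] with α hα
  have hprod := (integrable_prod_rescaled_kernel hm hh hF hω hα).mono_measure
    (Measure.prod_mono (Measure.restrict_le_self (s := Ξ)) le_rfl)
  rw [integral_integral_swap hprod]
  refine integral_congr_ae (ae_of_all _ fun a => ?_)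
  exact ((integral_const_mul _ _).trans (congrArg _ integral_complex_ofReal)).symm

theorem integrable_inv_sqrt_pi_mul_exp_neg_sq :
    Integrable fun t : ℝ => (√π)⁻¹ * Real.exp (-t ^ 2) := by
  simpa using (integrable_exp_neg_mul_sq one_pos).const_mul (√π)⁻¹

theorem integral_inv_sqrt_pi_mul_exp_neg_sq :
    ∫ t : ℝ, (√π)⁻¹ * Real.exp (-t ^ 2) = 1 := by
  have hg := integral_gaussian 1
  simp only [neg_mul, one_mul, div_one] at hg
  rw [integral_const_mul, hg, inv_mul_cancel₀ (Real.sqrt_pos.2 pi_pos).ne']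

/-- Gaussian-kernel localization: for a measurable `A ⊆ (0,∞)`, `g` measurable
with `a ↦ g(a) a^{−3/2}` integrable on `A`, `ω` measurable, and `Ξ` open with
`{a ∈ A : ω(a) ∈ ∂Ξ}` of measure zero, with `h(t) = π^{−1/2} e^{−t²}`:
`lim_{α→0⁺} ∫_Ξ (∫_A g(a) α⁻¹ h(|ξ − ω(a)|/α) a^{−3/2} da) dξ
  = ∫_{A ∩ {ω ∈ Ξ}} g(a) a^{−3/2} da`. -/
theorem statement14
    (A : Set ℝ) (hA : MeasurableSet A) (hA0 : A ⊆ Set.Ioi (0 : ℝ))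
    (g : ℝ → ℂ) (hg : Measurable g)
    (hgint : IntegrableOn (fun a : ℝ => g a * ((a ^ (-(3 : ℝ) / 2) : ℝ) : ℂ)) A volume)
    (ω : ℝ → ℝ) (hω : Measurable ω)
    (Ξ : Set ℝ) (hΞ : IsOpen Ξ)
    (hfr : volume {a : ℝ | a ∈ A ∧ ω a ∈ frontier Ξ} = 0) :
    Filter.Tendsto
      (fun α : ℝ =>
        ∫ ξ in Ξ, ∫ a in A,
          g a * ((α⁻¹ * (Real.sqrt π)⁻¹ * Real.exp (-(|ξ - ω a| / α) ^ 2) *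
              a ^ (-(3 : ℝ) / 2) : ℝ) : ℂ))
      (nhdsWithin 0 (Set.Ioi 0))
      (nhds (∫ a in A ∩ {a : ℝ | ω a ∈ Ξ}, g a * ((a ^ (-(3 : ℝ) / 2) : ℝ) : ℂ))) := by
  have hae : ∀ᵐ a ∂volume.restrict A, ω a ∉ frontier Ξ := by
    rw [ae_restrict_iff' hA, ae_iff]
    simpa using hfr
  have hmain := tendsto_setIntegral_integral_rescaled_kernel (by fun_prop)
    integrable_inv_sqrt_pi_mul_exp_neg_sq hgint hω hΞ.measurableSet hae
  rw [integral_inv_sqrt_pi_mul_exp_neg_sq, Complex.ofReal_one, mul_one,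
    Measure.restrict_restrict (hω hΞ.measurableSet), Set.inter_comm] at hmain
  refine hmain.congr fun α => ?_
  congr! 4 with ξ a
  rw [div_pow, div_pow, sq_abs]
  push_cast
  ring
end
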